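/- Let |q| < 1, x, y ∈ S(q), |ρ| < 1, and let i, j ≥ 0 be integers. Then H_i(x|q) H_j(y|q) · (∏_{k=0}^{∞} ω(x√(1-q)/2, y√(1-q)/2 | ρ q^k)) / (ρ²;q)_∞ = Σ_{k=0}^{∞} (-1)^k q^{k(k-1)/2} (ρ^k/[k]_q!) Q_{i+k,j+k}(x,y|ρ,q), the series on the right converging. -/

import Mathlib

open Finset MeasureTheory

noncomputable section

/-- [n]_q = 1 + q + ... + q^{n-1} -/
def qNat (q : ℝ) (n : ℕ) : ℝ := ∑ j ∈ Finset.range n, q ^ j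

/-- [n]_q! -/
def qFact (q : ℝ) : ℕ → ℝ
  | 0 => 1
  | n + 1 => qFact q n * qNat q (n + 1)

/-- q-binomial coefficient -/
def qBinom (q : ℝ) (n k : ℕ) : ℝ :=
  if k ≤ n then qFact q n / (qFact q (n - k) * qFact q k) else 0

/-- q-Pochhammer symbol (a;q)_n -/
def qPoch (a q : ℝ) (n : ℕ) : ℝ := ∏ j ∈ Finset.range n, (1 - a * q ^ j)

/-- q-Pochhammer symbol (a;q)_∞ -/
def qPochInf (a q : ℝ) : ℝ := ∏' j : ℕ, (1 - a * q ^ j)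

/-- continuous q-Hermite polynomials H_n(x|q) -/
def qHermite (q : ℝ) : ℕ → ℝ → ℝ
  | 0, _ => 1
  | 1, x => x
  | n + 2, x => x * qHermite q (n + 1) x - qNat q (n + 1) * qHermite q n x

/-- big q-Hermite polynomials H_n(x|a,q) -/
def bigqHermite (q a : ℝ) : ℕ → ℝ → ℝ
  | 0, _ => 1
  | 1, x => x - a
  | n + 2, x => (x - a * q ^ (n + 1)) * bigqHermite q a (n + 1) x -
      qNat q (n + 1) * bigqHermite q a n x

/-- rescaled Al-Salam--Chihara polynomials P_n(x|y,ρ,q) -/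
def ascP (q y ρ : ℝ) : ℕ → ℝ → ℝ
  | 0, _ => 1
  | 1, x => x - ρ * y
  | n + 2, x => (x - ρ * y * q ^ (n + 1)) * ascP q y ρ (n + 1) x -
      qNat q (n + 1) * (1 - ρ ^ 2 * q ^ n) * ascP q y ρ n x

/-- generating function φ_H(x|t,q) of the q-Hermite polynomials -/
def phiH (q t x : ℝ) : ℝ := ∑' n : ℕ, t ^ n / qFact q n * qHermite q n x

/-- γ_{i,j}(x,y|ρ,q) -/
def gammaPM (q ρ : ℝ) (i j : ℕ) (x y : ℝ) : ℝ :=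
  ∑' n : ℕ, ρ ^ n / qFact q n * qHermite q (n + i) x * qHermite q (n + j) y

/-- the polynomials Q_{i,j}(x,y|ρ,q) -/
def Qpoly (q ρ : ℝ) (i j : ℕ) (x y : ℝ) : ℝ :=
  ∑ s ∈ Finset.range (j + 1),
    (-1 : ℝ) ^ s * q ^ (s * (s - 1) / 2) * qBinom q j s * ρ ^ s * qHermite q (j - s) y *
      ascP q y ρ (i + s) x / qPoch (ρ ^ 2) q (i + s)

/-- the interval S(q) = [-2/√(1-q), 2/√(1-q)] -/
def Sq (q : ℝ) : Set ℝ := Set.Icc (-(2 / Real.sqrt (1 - q))) (2 / Real.sqrt (1 - q))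

/-- ω(x,y|ρ) -/
def omegaPM (x y ρ : ℝ) : ℝ :=
  (1 - ρ ^ 2) ^ 2 - 4 * ρ * (1 + ρ ^ 2) * x * y + 4 * ρ ^ 2 * (x ^ 2 + y ^ 2)

/-- l(x|a) -/
def lPM (x a : ℝ) : ℝ := (1 + a) ^ 2 - 4 * a * x ^ 2

/-- the q-Normal density f_N(x|q) -/
def fN (q x : ℝ) : ℝ :=
  Real.sqrt ((1 - q) * (4 - (1 - q) * x ^ 2)) * qPochInf q q / (2 * Real.pi) *
    ∏' j : ℕ, lPM (x * Real.sqrt (1 - q) / 2) (q ^ (j + 1))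

/-- the (q,ρ)-Conditional Normal density f_CN(x|y,ρ,q) -/
def fCN (q ρ x y : ℝ) : ℝ :=
  fN q x * qPochInf (ρ ^ 2) q /
    ∏' j : ℕ, omegaPM (x * Real.sqrt (1 - q) / 2) (y * Real.sqrt (1 - q) / 2) (ρ * q ^ j)

/-- the (ρ,q)-bivariate Normal density f_{2D}(x,y|ρ,q) -/
def f2D (q ρ x y : ℝ) : ℝ := fCN q ρ x y * fN q y

theorem qNat_eq (q : ℝ) (hq : |q| < 1) (n : ℕ) : qNat q n = (1 - q ^ n) / (1 - q) := by
  have h1 : q ≠ 1 := by rintro rfl; simp at hq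
  rw [qNat, geom_sum_eq h1, ← neg_div_neg_eq]
  ring

theorem one_sub_mul_qNat (q : ℝ) (n : ℕ) : (1 - q) * qNat q n = 1 - q ^ n :=
  mul_neg_geom_sum q n

@[simp] theorem qNat_zero (q : ℝ) : qNat q 0 = 0 := by simp [qNat]

@[simp] theorem qNat_one (q : ℝ) : qNat q 1 = 1 := by simp [qNat]

theorem qNat_add (q : ℝ) (m n : ℕ) : qNat q (m + n) = qNat q m + q ^ m * qNat q n := by
  simp only [qNat, Finset.sum_range_add, pow_add, Finset.mul_sum]

theorem qNat_succ_pos {q : ℝ} (hq : |q| < 1) (n : ℕ) : 0 < qNat q (n + 1) := by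
  rw [qNat_eq q hq]
  have h : q ^ (n + 1) < 1 := (le_abs_self _).trans_lt
    (by rw [abs_pow]; exact pow_lt_one₀ (abs_nonneg q) hq n.succ_ne_zero)
  exact div_pos (by linarith) (by linarith [(abs_lt.1 hq).2])

theorem qFact_pos {q : ℝ} (hq : |q| < 1) : ∀ n, 0 < qFact q n
  | 0 => one_pos
  | n + 1 => mul_pos (qFact_pos hq n) (qNat_succ_pos hq n)

theorem qBinom_zero_right {q : ℝ} (hq : |q| < 1) (n : ℕ) : qBinom q n 0 = 1 := by
  simp [qBinom, qFact, (qFact_pos hq n).ne']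

theorem qBinom_eq_zero {q : ℝ} {n k : ℕ} (h : n < k) : qBinom q n k = 0 := by
  simp [qBinom, h.not_ge]

theorem qBinom_add {q : ℝ} (d s : ℕ) :
    qBinom q (d + s) s = qFact q (d + s) / (qFact q d * qFact q s) := by
  simp [qBinom]

theorem qBinom_succ_succ {q : ℝ} (hq : |q| < 1) (d s : ℕ) :
    qBinom q (d + s + 1) (s + 1) = qBinom q (d + s) (s + 1) + q ^ d * qBinom q (d + s) s := by
  have hs := (qFact_pos hq s).ne'
  have hs1 := (qNat_succ_pos hq s).ne'
  rw [add_assoc, qBinom_add, qBinom_add]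
  cases d with
  | zero =>
    have hs2 := (qFact_pos hq (s + 1)).ne'
    rw [qBinom_eq_zero (by omega)]
    simp [qFact, hs, hs1]
  | succ e =>
    have he := (qFact_pos hq e).ne'
    have he1 := (qNat_succ_pos hq e).ne'
    rw [show e + 1 + s = e + (s + 1) by ring, qBinom_add,
      show e + 1 + (s + 1) = e + (s + 1) + 1 by ring]
    simp only [qFact]
    rw [show e + (s + 1) + 1 = (e + 1) + (s + 1) by ring]
    field_simp
    rw [qNat_add q (e + 1)]
    ring

theorem qBinom_mul_qNat_sub {q : ℝ} (hq : |q| < 1) (d s : ℕ) :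
    qBinom q (d + s + 1) s * qNat q (d + 1) = qNat q (d + s + 1) * qBinom q (d + s) s := by
  have hs := (qFact_pos hq s).ne'
  have hd := (qFact_pos hq d).ne'
  have hd1 := (qNat_succ_pos hq d).ne'
  rw [add_right_comm, qBinom_add, qBinom_add, add_right_comm]
  simp only [qFact]
  field_simp

theorem qHermite_succ (q : ℝ) (n : ℕ) (x : ℝ) :
    qHermite q (n + 1) x = x * qHermite q n x - qNat q n * qHermite q (n - 1) x := by
  cases n <;> simp [qHermite]

/-- The alternating `q`-binomial transform `∑ (-1)^s q^(s(s-1)/2) [n choose s]_q g s`. -/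
def qAltSum (q : ℝ) (n : ℕ) (g : ℕ → ℝ) : ℝ :=
  ∑ s ∈ Finset.range (n + 1), (-1 : ℝ) ^ s * q ^ (s * (s - 1) / 2) * qBinom q n s * g s

theorem qAltSum_zero {q : ℝ} (hq : |q| < 1) (g : ℕ → ℝ) : qAltSum q 0 g = g 0 := by
  simp [qAltSum, qBinom_zero_right hq]

theorem qAltSum_succ {q : ℝ} (hq : |q| < 1) (n : ℕ) (g : ℕ → ℝ) :
    qAltSum q (n + 1) g = qAltSum q n g - q ^ n * qAltSum q n (fun s => g (s + 1)) := by
  have h : qAltSum q n g =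
      ∑ s ∈ Finset.range (n + 2), (-1 : ℝ) ^ s * q ^ (s * (s - 1) / 2) * qBinom q n s * g s := by
    rw [Finset.sum_range_succ, qBinom_eq_zero (Nat.lt_succ_self n), qAltSum]
    simp
  rw [h, qAltSum, qAltSum, Finset.sum_range_succ', Finset.sum_range_succ' _ (n + 1),
    qBinom_zero_right hq, qBinom_zero_right hq, Finset.mul_sum, add_sub_right_comm,
    ← Finset.sum_sub_distrib]
  congr 1
  refine Finset.sum_congr rfl fun s hs => ?_
  obtain ⟨d, rfl⟩ := Nat.exists_eq_add_of_le' (Nat.lt_succ_iff.1 (Finset.mem_range.1 hs))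
  rw [qBinom_succ_succ hq, Nat.triangle_succ]
  ring

theorem qAltSum_one_eq_zero {q : ℝ} (hq : |q| < 1) (n : ℕ) :
    qAltSum q (n + 1) (fun _ => 1) = 0 := by
  induction n with
  | zero => simp [qAltSum_succ hq]
  | succ n ih => rw [qAltSum_succ hq, ih]; simp

theorem qAltSum_qHermite_succ {q : ℝ} (hq : |q| < 1) (n : ℕ) (y : ℝ) (g : ℕ → ℝ) :
    qAltSum q (n + 1) (fun s => qHermite q (n + 1 - s) y * g s) =
      y * qAltSum q n (fun s => qHermite q (n - s) y * g s)
        - qNat q n * qAltSum q (n - 1) (fun s => qHermite q (n - 1 - s) y * g s)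
        - q ^ n * qAltSum q n (fun s => qHermite q (n - s) y * g (s + 1)) := by
  rw [qAltSum_succ hq]
  simp only [Nat.add_sub_add_right]
  congr 1
  cases n with
  | zero => simp [qAltSum_zero hq, qHermite]
  | succ n =>
    have h : qAltSum q n (fun s => qHermite q (n - s) y * g s) * qNat q (n + 1) =
        ∑ s ∈ Finset.range (n + 1 + 1), (-1 : ℝ) ^ s * q ^ (s * (s - 1) / 2) *
          (qBinom q (n + 1) s * qNat q (n + 1 - s)) * (qHermite q (n - s) y * g s) := by
      rw [Finset.sum_range_succ, Nat.sub_self, qNat_zero, qAltSum, Finset.sum_mul]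
      simp only [mul_zero, zero_mul, add_zero]
      refine Finset.sum_congr rfl fun s hs => ?_
      obtain ⟨d, rfl⟩ := Nat.exists_eq_add_of_le' (Nat.lt_succ_iff.1 (Finset.mem_range.1 hs))
      rw [show d + s + 1 - s = d + 1 by omega, qBinom_mul_qNat_sub hq]
      ring
    rw [Nat.add_sub_cancel, mul_comm (qNat q _), h, qAltSum, qAltSum, Finset.mul_sum,
      ← Finset.sum_sub_distrib]
    refine Finset.sum_congr rfl fun s hs => ?_
    have hs' : s ≤ n + 1 := Nat.lt_succ_iff.1 (Finset.mem_range.1 hs)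
    rw [show n + 1 + 1 - s = (n + 1 - s) + 1 by omega, qHermite_succ,
      show n + 1 - s - 1 = n - s by omega]
    ring

theorem one_sub_pos_of_abs_lt_one {q : ℝ} (hq : |q| < 1) : 0 < 1 - q := by
  linarith [(abs_lt.1 hq).2]

theorem prod_one_add_le_exp_tsum {u : ℕ → ℝ} (hu : ∀ n, 0 ≤ u n) (hs : Summable u) (n : ℕ) :
    ∏ k ∈ Finset.range n, (1 + u k) ≤ Real.exp (∑' k, u k) :=
  (Real.prod_one_add_le_exp_sum _ hu).trans
    (Real.exp_le_exp.2 (hs.sum_le_tsum _ fun k _ => hu k))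

theorem exists_one_div_qFact_le {q : ℝ} (hq : |q| < 1) :
    ∃ K, 0 ≤ K ∧ ∀ n, 1 / qFact q n ≤ K * (1 - q) ^ n := by
  have h0 := one_sub_pos_of_abs_lt_one hq
  have h1 : 0 < 1 - |q| := by linarith
  have hs : Summable fun n : ℕ => |q| ^ (n + 1) / (1 - |q|) :=
    ((summable_nat_add_iff 1).2 (summable_geometric_of_lt_one (abs_nonneg q) hq)).div_const _
  refine ⟨Real.exp (∑' n : ℕ, |q| ^ (n + 1) / (1 - |q|)), (Real.exp_pos _).le, fun n => ?_⟩
  suffices h : 1 / qFact q n ≤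
      (∏ k ∈ Finset.range n, (1 + |q| ^ (k + 1) / (1 - |q|))) * (1 - q) ^ n from
    h.trans (mul_le_mul_of_nonneg_right
      (prod_one_add_le_exp_tsum (fun k => by positivity) hs n) (by positivity))
  induction n with
  | zero => simp [qFact]
  | succ n ih =>
    have hN := qNat_succ_pos hq n
    have ht : |q| ^ (n + 1) ≤ |q| := pow_le_of_le_one (abs_nonneg q) hq.le n.succ_ne_zero
    have hqt : q ^ (n + 1) ≤ |q| ^ (n + 1) := (le_abs_self _).trans_eq (abs_pow q _)
    have ht0 : 0 ≤ |q| ^ (n + 1) := by positivity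
    set t := |q| ^ (n + 1)
    have h2 : 1 / qNat q (n + 1) ≤ (1 + t / (1 - |q|)) * (1 - q) := by
      rw [div_le_iff₀ hN, mul_assoc, one_sub_mul_qNat]
      have h3 : t ≤ t / (1 - |q|) * (1 - t) := by
        rw [div_mul_eq_mul_div, le_div_iff₀ h1]
        exact mul_le_mul_of_nonneg_left (by linarith) ht0
      calc (1 : ℝ) ≤ (1 + t / (1 - |q|)) * (1 - t) := by linarith
        _ ≤ _ := by gcongr
    calc 1 / qFact q (n + 1) = 1 / qFact q n * (1 / qNat q (n + 1)) := by
          rw [qFact, one_div_mul_one_div]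
      _ ≤ _ := mul_le_mul ih h2 (by positivity) (by
          refine mul_nonneg (Finset.prod_nonneg fun k _ => ?_) (by positivity)
          positivity)
      _ = _ := by rw [Finset.prod_range_succ]; ring

theorem abs_mul_sqrt_le_of_mem_Sq {q x : ℝ} (hq : |q| < 1) (hx : x ∈ Sq q) :
    |x * √(1 - q) / 2| ≤ 1 := by
  have h0 : 0 < √(1 - q) := Real.sqrt_pos.2 (one_sub_pos_of_abs_lt_one hq)
  have h : |x| ≤ 2 / √(1 - q) := abs_le.2 hx
  rw [le_div_iff₀ h0] at h
  rw [abs_div, abs_mul, abs_of_pos h0, abs_two]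
  linarith

theorem exists_abs_qHermite_le {q x : ℝ} (hq : |q| < 1) (hx : x ∈ Sq q) :
    ∃ C, 0 ≤ C ∧ ∀ n : ℕ, |√(1 - q) ^ n * qHermite q n x| ≤ C * (n + 1) := by
  have ha : √(1 - q) ^ 2 = 1 - q := Real.sq_sqrt (one_sub_pos_of_abs_lt_one hq).le
  have hc := abs_mul_sqrt_le_of_mem_Sq hq hx
  set a := √(1 - q)
  set c := x * a / 2 with hc_def
  set h : ℕ → ℝ := fun n => a ^ n * qHermite q n x with hh
  have hrec (n : ℕ) : h (n + 2) = 2 * c * h (n + 1) - (1 - q ^ (n + 1)) * h n := by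
    rw [← one_sub_mul_qNat, ← ha]
    simp only [hh, hc_def, qHermite]
    ring
  have hc1 : 0 ≤ 1 - c ^ 2 := by nlinarith [abs_le.1 hc]
  have hb : √(1 - c ^ 2) ^ 2 = 1 - c ^ 2 := Real.sq_sqrt hc1
  set b := √(1 - c ^ 2)
  set e : ℂ := ⟨c, b⟩ with he
  set e' : ℂ := ⟨c, -b⟩ with he'
  have hmul : e' * e = 1 := by
    apply Complex.ext <;> simp [he, he'] <;> linarith
  have hadd : e' + e = 2 * c := by
    apply Complex.ext <;> simp [he, he']; ring
  have hen : ‖e‖ = 1 := by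
    have : ‖e‖ ^ 2 = 1 := by
      rw [← Complex.normSq_eq_norm_sq, he, Complex.normSq_mk]
      linarith
    exact (pow_eq_one_iff_of_nonneg (norm_nonneg e) two_ne_zero).1 this
  have hen' : ‖e'‖ = 1 := by
    have := congrArg norm hmul
    simpa [hen] using this
  set d : ℕ → ℂ := fun n => (h (n + 1) : ℂ) - e * h n with hd
  have hdrec (n : ℕ) : d (n + 1) = e' * d n + (q : ℂ) ^ (n + 1) * h n := by
    simp only [hd, hrec n]
    push_cast
    linear_combination (-(h (n + 1) : ℂ)) * hadd + (h n : ℂ) * hmul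
  set u : ℕ → ℝ := fun n => (n + 1) * |q| ^ (n + 1) with hu
  have hu0 (n : ℕ) : 0 ≤ u n := by positivity
  have hus : Summable u := by
    have h1 : Summable fun n : ℕ => (n : ℝ) ^ 1 * |q| ^ n :=
      summable_pow_mul_geometric_of_norm_lt_one 1 (by simpa using hq)
    simpa [hu] using (summable_nat_add_iff 1).2 h1
  set D : ℕ → ℝ := fun n => ∏ k ∈ Finset.range n, (1 + u k) with hD
  have hDs (n : ℕ) : D (n + 1) = D n * (1 + u n) := Finset.prod_range_succ ..
  have hD0 (n : ℕ) : 0 ≤ D n := Finset.prod_nonneg fun k _ => by linarith [hu0 k]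
  have key (n : ℕ) : |h n| ≤ D n * (n + 1) ∧ ‖d n‖ ≤ D n := by
    induction n with
    | zero =>
      have h1 : d 0 = e' := by
        have : h 1 = 2 * c := by simp only [hh, hc_def, qHermite]; ring
        have h0 : h 0 = 1 := by simp [hh, qHermite]
        simp only [hd, zero_add, this, h0]
        push_cast
        linear_combination -hadd
      refine ⟨by simp [hh, hD, qHermite], ?_⟩
      rw [h1, hen']
      simp [hD]
    | succ n ih =>
      obtain ⟨ih1, ih2⟩ := ih
      have h1 : ‖d (n + 1)‖ ≤ D (n + 1) := by
        rw [hdrec, hDs]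
        calc _ ≤ ‖e' * d n‖ + ‖(q : ℂ) ^ (n + 1) * h n‖ := norm_add_le _ _
          _ = ‖d n‖ + |q| ^ (n + 1) * |h n| := by simp [hen']
          _ ≤ D n + |q| ^ (n + 1) * (D n * (n + 1)) := by gcongr
          _ = _ := by simp only [hu]; ring
      refine ⟨?_, h1⟩
      have h2 : (h (n + 1) : ℂ) = d n + e * h n := by simp [hd]
      have h3 : D n ≤ D (n + 1) := by
        rw [hDs]; nlinarith [hD0 n, hu0 n]
      calc |h (n + 1)| = ‖(h (n + 1) : ℂ)‖ := by simp
        _ ≤ ‖d n‖ + ‖e * h n‖ := by rw [h2]; exact norm_add_le _ _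
        _ = ‖d n‖ + |h n| := by simp [hen]
        _ ≤ D n + D n * (n + 1) := by gcongr
        _ = D n * (n + 1 + 1) := by ring
        _ ≤ D (n + 1) * ((n + 1 : ℕ) + 1) := by push_cast; gcongr
  refine ⟨Real.exp (∑' n, u n), (Real.exp_pos _).le, fun n => (key n).1.trans ?_⟩
  gcongr
  exact prod_one_add_le_exp_tsum hu0 hus n

theorem exists_quadratic_mul_pow_le (i j : ℕ) {r : ℝ} (h0 : 0 ≤ r) (h1 : r < 1) :
    ∃ M, ∀ n : ℕ, ((n + i : ℕ) + 1 : ℝ) * ((n + j : ℕ) + 1) * r ^ n ≤ M := by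
  have h (k : ℕ) := tendsto_pow_const_mul_const_pow_of_lt_one k h0 h1
  have := ((h 2).add ((h 1).const_mul (i + j + 2 : ℝ))).add
    ((h 0).const_mul ((i + 1) * (j + 1) : ℝ))
  obtain ⟨M, hM⟩ := this.bddAbove_range
  refine ⟨M, fun n => le_trans (le_of_eq ?_) (hM ⟨n, rfl⟩)⟩
  push_cast
  ring

/-- The general term of the double series obtained by expanding each `γ_{i+k,j+k}`. -/
def gammaDoubleTerm (q ρ : ℝ) (i j : ℕ) (x y : ℝ) (p : ℕ × ℕ) : ℝ :=
  (-1 : ℝ) ^ p.1 * q ^ (p.1 * (p.1 - 1) / 2) * ρ ^ p.1 / qFact q p.1 *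
    (ρ ^ p.2 / qFact q p.2 * qHermite q (p.2 + (i + p.1)) x * qHermite q (p.2 + (j + p.1)) y)

theorem summable_gammaDoubleTerm {q ρ x y : ℝ} (hq : |q| < 1) (hρ : |ρ| < 1)
    (hx : x ∈ Sq q) (hy : y ∈ Sq q) (i j : ℕ) : Summable (gammaDoubleTerm q ρ i j x y) := by
  have h0 := one_sub_pos_of_abs_lt_one hq
  obtain ⟨K, hK0, hK⟩ := exists_one_div_qFact_le hq
  obtain ⟨C, hC0, hC⟩ := exists_abs_qHermite_le hq hx
  obtain ⟨C', hC0', hC'⟩ := exists_abs_qHermite_le hq hy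
  have ha : √(1 - q) ^ 2 = 1 - q := Real.sq_sqrt h0.le
  have ha0 : 0 < √(1 - q) := Real.sqrt_pos.2 h0
  set a := √(1 - q)
  have hr2 : √|ρ| ^ 2 = |ρ| := Real.sq_sqrt (abs_nonneg ρ)
  have hr0 : 0 ≤ √|ρ| := Real.sqrt_nonneg _
  have hr1 : √|ρ| < 1 := by rw [Real.sqrt_lt' one_pos]; simpa using hρ
  set r := √|ρ|
  obtain ⟨M, hM⟩ := exists_quadratic_mul_pow_le i j hr0 hr1
  have hg := summable_geometric_of_lt_one hr0 hr1
  have hgg := (hg.mul_of_nonneg hg (fun n => by positivity) (fun n => by positivity)).mul_left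
    (K * K * C * C' * M / a ^ (i + j))
  refine Summable.of_norm_bounded hgg fun ⟨k, n⟩ => ?_
  have hF (m : ℕ) : 0 < qFact q m := qFact_pos hq m
  have hqk : |q| ^ (k * (k - 1) / 2) ≤ 1 := pow_le_one₀ (abs_nonneg q) hq.le
  have hX := hC (n + k + i)
  have hY := hC' (n + k + j)
  rw [abs_mul, abs_of_pos (by positivity)] at hX hY
  simp only [gammaDoubleTerm, Real.norm_eq_abs, abs_mul, abs_div, abs_pow, abs_neg, abs_one,
    one_pow, one_mul, abs_of_pos (hF _), show n + (i + k) = n + k + i by ring,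
    show n + (j + k) = n + k + j by ring]
  set Hx := |qHermite q (n + k + i) x|
  set Hy := |qHermite q (n + k + j) y|
  have hHx : 0 ≤ Hx := abs_nonneg _
  have hHy : 0 ≤ Hy := abs_nonneg _
  rw [div_mul_eq_mul_div (_ * M), le_div_iff₀ (by positivity)]
  calc _ = |q| ^ (k * (k - 1) / 2) * (1 / qFact q k) * (1 / qFact q n) *
        (|ρ| ^ (k + n) * (Hx * Hy * a ^ (i + j))) := by ring
    _ ≤ 1 * (K * (1 - q) ^ k) * (K * (1 - q) ^ n) *
        (|ρ| ^ (k + n) * (Hx * Hy * a ^ (i + j))) := by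
      have hk := hF k
      have hn := hF n
      gcongr
      · exact hK k
      · exact hK n
    _ = K * K * |ρ| ^ (k + n) * ((a ^ (n + k + i) * Hx) * (a ^ (n + k + j) * Hy)) := by
      rw [← ha]; ring
    _ ≤ K * K * |ρ| ^ (k + n) *
        ((C * ((n + k + i : ℕ) + 1)) * (C' * ((n + k + j : ℕ) + 1))) := by gcongr
    _ = K * K * C * C' * r ^ (k + n) *
        (((n + k + i : ℕ) + 1) * ((n + k + j : ℕ) + 1) * r ^ (n + k)) := by
      rw [← hr2]; ring
    _ ≤ K * K * C * C' * r ^ (k + n) * M := by gcongr; exact hM (n + k)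
    _ = _ := by ring

theorem hasSum_of_forall_eq {f g : ℕ → ℝ} {a : ℝ} (hf : HasSum f a) (h : ∀ n, g n = f n) :
    HasSum g a :=
  (funext h : g = f) ▸ hf

/-- The general term of the series defining `γ_{i,j}`. -/
def gammaTerm (q ρ : ℝ) (i j : ℕ) (x y : ℝ) (n : ℕ) : ℝ :=
  ρ ^ n / qFact q n * qHermite q (n + i) x * qHermite q (n + j) y

theorem summable_gammaTerm {q ρ x y : ℝ} (hq : |q| < 1) (hρ : |ρ| < 1)
    (hx : x ∈ Sq q) (hy : y ∈ Sq q) (i j : ℕ) : Summable (gammaTerm q ρ i j x y) := by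
  have h := (summable_gammaDoubleTerm hq hρ hx hy i j).comp_injective
    (Prod.mk_right_injective 0)
  refine h.congr fun n => ?_
  simp [gammaDoubleTerm, gammaTerm, qFact]

theorem hasSum_gammaPM {q ρ x y : ℝ} (hq : |q| < 1) (hρ : |ρ| < 1)
    (hx : x ∈ Sq q) (hy : y ∈ Sq q) (i j : ℕ) :
    HasSum (gammaTerm q ρ i j x y) (gammaPM q ρ i j x y) :=
  (summable_gammaTerm hq hρ hx hy i j).hasSum

theorem gammaPM_comm (q ρ : ℝ) (i j : ℕ) (x y : ℝ) :
    gammaPM q ρ i j x y = gammaPM q ρ j i y x :=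
  tsum_congr fun n => by ring

theorem hasSum_qNat_mul {q ρ x y : ℝ} (hq : |q| < 1) (hρ : |ρ| < 1)
    (hx : x ∈ Sq q) (hy : y ∈ Sq q) (i j : ℕ) :
    HasSum (fun n => qNat q n * (ρ ^ n / qFact q n) * qHermite q (n + i) x *
      qHermite q (n + j - 1) y) (ρ * gammaPM q ρ (i + 1) j x y) := by
  rw [← hasSum_nat_add_iff' 1]
  simp only [Finset.sum_range_one, qNat_zero, zero_mul, sub_zero]
  refine hasSum_of_forall_eq ((hasSum_gammaPM hq hρ hx hy (i + 1) j).mul_left ρ) fun n => ?_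
  have h1 := (qFact_pos hq n).ne'
  have h2 := (qNat_succ_pos hq n).ne'
  rw [gammaTerm, show n + 1 + i = n + (i + 1) by ring, show n + 1 + j - 1 = n + j by omega, qFact,
    pow_succ]
  field_simp

theorem gammaPM_succ_right {q ρ x y : ℝ} (hq : |q| < 1) (hρ : |ρ| < 1)
    (hx : x ∈ Sq q) (hy : y ∈ Sq q) (i j : ℕ) :
    gammaPM q ρ i (j + 1) x y = y * gammaPM q ρ i j x y - qNat q j * gammaPM q ρ i (j - 1) x y
      - q ^ j * (ρ * gammaPM q ρ (i + 1) j x y) := by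
  refine (hasSum_gammaPM hq hρ hx hy i (j + 1)).unique ?_
  refine hasSum_of_forall_eq ((((hasSum_gammaPM hq hρ hx hy i j).mul_left y).sub
    ((hasSum_gammaPM hq hρ hx hy i (j - 1)).mul_left (qNat q j))).sub
    ((hasSum_qNat_mul hq hρ hx hy i j).mul_left (q ^ j))) fun n => ?_
  have h : qNat q j * qHermite q (n + (j - 1)) y = qNat q j * qHermite q (n + j - 1) y := by
    cases j <;> simp [← add_assoc]
  simp only [gammaTerm]
  rw [← add_assoc, qHermite_succ, add_comm n j, qNat_add, add_comm j n]
  linear_combination (ρ ^ n / qFact q n * qHermite q (n + i) x) * h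

theorem gammaPM_succ_left {q ρ x y : ℝ} (hq : |q| < 1) (hρ : |ρ| < 1)
    (hx : x ∈ Sq q) (hy : y ∈ Sq q) (i j : ℕ) :
    gammaPM q ρ (i + 1) j x y = x * gammaPM q ρ i j x y - qNat q i * gammaPM q ρ (i - 1) j x y
      - q ^ i * (ρ * gammaPM q ρ i (j + 1) x y) := by
  simp only [gammaPM_comm q ρ _ _ x y]
  exact gammaPM_succ_right hq hρ hy hx j i

theorem sq_mul_pow_lt_one {q ρ : ℝ} (hq : |q| < 1) (hρ : |ρ| < 1) (n : ℕ) :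
    0 < 1 - ρ ^ 2 * q ^ n := by
  have h : |ρ ^ 2 * q ^ n| < 1 := by
    rw [abs_mul, abs_pow, abs_pow]
    exact mul_lt_one_of_nonneg_of_lt_one_left (by positivity)
      (pow_lt_one₀ (abs_nonneg _) hρ two_ne_zero) (pow_le_one₀ (abs_nonneg _) hq.le)
  linarith [le_abs_self (ρ ^ 2 * q ^ n)]

theorem qPoch_succ (a q : ℝ) (n : ℕ) : qPoch a q (n + 1) = qPoch a q n * (1 - a * q ^ n) :=
  Finset.prod_range_succ ..

theorem qPoch_sq_pos {q ρ : ℝ} (hq : |q| < 1) (hρ : |ρ| < 1) (n : ℕ) : 0 < qPoch (ρ ^ 2) q n :=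
  Finset.prod_pos fun k _ => sq_mul_pow_lt_one hq hρ k

theorem one_sub_mul_gammaPM_succ_zero {q ρ x y : ℝ} (hq : |q| < 1) (hρ : |ρ| < 1)
    (hx : x ∈ Sq q) (hy : y ∈ Sq q) (i : ℕ) :
    (1 - ρ ^ 2 * q ^ i) * gammaPM q ρ (i + 1) 0 x y =
      (x - ρ * y * q ^ i) * gammaPM q ρ i 0 x y - qNat q i * gammaPM q ρ (i - 1) 0 x y := by
  have h1 := gammaPM_succ_left hq hρ hx hy i 0
  have h2 := gammaPM_succ_right hq hρ hx hy i 0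
  simp only [qNat_zero, pow_zero] at h2
  linear_combination h1 - q ^ i * ρ * h2

theorem qPoch_mul_gammaPM_zero {q ρ x y : ℝ} (hq : |q| < 1) (hρ : |ρ| < 1)
    (hx : x ∈ Sq q) (hy : y ∈ Sq q) (i : ℕ) :
    qPoch (ρ ^ 2) q i * gammaPM q ρ i 0 x y = ascP q y ρ i x * gammaPM q ρ 0 0 x y := by
  induction i using Nat.twoStepInduction with
  | zero => simp [qPoch, ascP]
  | one =>
    have := one_sub_mul_gammaPM_succ_zero hq hρ hx hy 0
    simpa [qPoch, ascP] using this
  | more n ih1 ih2 =>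
    have h := one_sub_mul_gammaPM_succ_zero hq hρ hx hy (n + 1)
    rw [Nat.add_sub_cancel] at h
    rw [ascP, qPoch_succ, qPoch_succ] at *
    linear_combination qPoch (ρ ^ 2) q n * (1 - ρ ^ 2 * q ^ n) * h +
      (x - ρ * y * q ^ (n + 1)) * ih2 - qNat q (n + 1) * (1 - ρ ^ 2 * q ^ n) * ih1

theorem gammaPM_eq_qAltSum {q ρ x y : ℝ} (hq : |q| < 1) (hρ : |ρ| < 1)
    (hx : x ∈ Sq q) (hy : y ∈ Sq q) (i j : ℕ) :
    gammaPM q ρ i j x y =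
      qAltSum q j (fun s => qHermite q (j - s) y * (ρ ^ s * gammaPM q ρ (i + s) 0 x y)) := by
  induction j using Nat.strong_induction_on generalizing i with
  | _ j ih =>
    cases j with
    | zero => simp [qAltSum_zero hq, qHermite]
    | succ j =>
      have h (s : ℕ) (t : ℝ) : t * (ρ ^ (s + 1) * gammaPM q ρ (i + (s + 1)) 0 x y) =
          ρ * (t * (ρ ^ s * gammaPM q ρ (i + 1 + s) 0 x y)) := by
        rw [show i + (s + 1) = i + 1 + s by ring]; ring
      rw [gammaPM_succ_right hq hρ hx hy, qAltSum_qHermite_succ hq, ih j (by omega),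
        ih (j - 1) (by omega), ih j (by omega) (i + 1)]
      simp only [h]
      congr 2
      simp only [qAltSum, Finset.mul_sum]
      exact Finset.sum_congr rfl fun s _ => by ring

/-- Carlitz's formula. -/
theorem gammaPM_eq_Qpoly_mul {q ρ x y : ℝ} (hq : |q| < 1) (hρ : |ρ| < 1)
    (hx : x ∈ Sq q) (hy : y ∈ Sq q) (i j : ℕ) :
    gammaPM q ρ i j x y = Qpoly q ρ i j x y * gammaPM q ρ 0 0 x y := by
  rw [gammaPM_eq_qAltSum hq hρ hx hy, qAltSum, Qpoly, Finset.sum_mul]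
  refine Finset.sum_congr rfl fun s _ => ?_
  have h := qPoch_mul_gammaPM_zero hq hρ hx hy (i + s)
  have h0 := (qPoch_sq_pos hq hρ (i + s)).ne'
  rw [eq_div_of_mul_eq h0 ((mul_comm _ _).trans h)]
  ring

theorem omegaPM_scaled {q : ℝ} (hq : |q| < 1) (x y ρ : ℝ) :
    omegaPM (x * √(1 - q) / 2) (y * √(1 - q) / 2) ρ =
      (1 - ρ ^ 2) ^ 2 - (1 - q) * ρ * (1 + ρ ^ 2) * x * y
        + (1 - q) * ρ ^ 2 * (x ^ 2 + y ^ 2) := by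
  have ha : √(1 - q) ^ 2 = 1 - q := Real.sq_sqrt (one_sub_pos_of_abs_lt_one hq).le
  rw [omegaPM]
  linear_combination (-ρ * (1 + ρ ^ 2) * x * y + ρ ^ 2 * (x ^ 2 + y ^ 2)) * ha

theorem gammaPM_mul_left {q ρ x y : ℝ} (hq : |q| < 1) (hρ : |ρ| < 1)
    (hx : x ∈ Sq q) (hy : y ∈ Sq q) :
    gammaPM q (ρ * q) 0 0 x y = gammaPM q ρ 0 0 x y - (1 - q) * (ρ * gammaPM q ρ 1 1 x y) := by
  have hρq : |ρ * q| < 1 := by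
    rw [abs_mul]; exact mul_lt_one_of_nonneg_of_lt_one_left (abs_nonneg ρ) hρ hq.le
  refine (hasSum_gammaPM hq hρq hx hy 0 0).unique ?_
  refine hasSum_of_forall_eq ((hasSum_gammaPM hq hρ hx hy 0 0).sub
    ((hasSum_qNat_mul hq hρ hx hy 0 1).mul_left (1 - q))) fun n => ?_
  have h := one_sub_mul_qNat q n
  simp only [gammaTerm, add_zero, Nat.add_sub_cancel]
  rw [mul_pow]
  linear_combination (ρ ^ n / qFact q n * qHermite q n x * qHermite q n y) * h

theorem omegaPM_mul_gammaPM {q ρ x y : ℝ} (hq : |q| < 1) (hρ : |ρ| < 1)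
    (hx : x ∈ Sq q) (hy : y ∈ Sq q) :
    omegaPM (x * √(1 - q) / 2) (y * √(1 - q) / 2) ρ * gammaPM q ρ 0 0 x y =
      (1 - ρ ^ 2) * (1 - ρ ^ 2 * q) * gammaPM q (ρ * q) 0 0 x y := by
  have h0 := one_sub_mul_gammaPM_succ_zero hq hρ hx hy 0
  have h1 := one_sub_mul_gammaPM_succ_zero hq hρ hx hy 1
  have h2 := gammaPM_succ_right hq hρ hx hy 1 0
  simp only [qNat_zero, qNat_one, pow_zero, pow_one, zero_add, one_mul, mul_one, zero_mul,
    sub_zero, Nat.reduceAdd, Nat.sub_self] at h0 h1 h2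
  rw [gammaPM_mul_left hq hρ hx hy, omegaPM_scaled hq, h2]
  linear_combination (1 - q) * ρ * ((1 - ρ ^ 2 * q) * y - ρ * (x - ρ * y * q)) * h0 -
    (1 - q) * ρ ^ 2 * (1 - ρ ^ 2) * h1

theorem prod_omegaPM_mul_gammaPM {q ρ x y : ℝ} (hq : |q| < 1) (hρ : |ρ| < 1)
    (hx : x ∈ Sq q) (hy : y ∈ Sq q) (N : ℕ) :
    (∏ k ∈ Finset.range N, omegaPM (x * √(1 - q) / 2) (y * √(1 - q) / 2) (ρ * q ^ k)) *
      gammaPM q ρ 0 0 x y = qPoch (ρ ^ 2) q (2 * N) * gammaPM q (ρ * q ^ N) 0 0 x y := by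
  induction N with
  | zero => simp [qPoch]
  | succ N ih =>
    have hρq : |ρ * q ^ N| < 1 := by
      rw [abs_mul, abs_pow]
      exact mul_lt_one_of_nonneg_of_lt_one_left (abs_nonneg ρ) hρ
        (pow_le_one₀ (abs_nonneg q) hq.le)
    have h := omegaPM_mul_gammaPM hq hρq hx hy
    rw [Finset.prod_range_succ, show 2 * (N + 1) = 2 * N + 1 + 1 by ring, qPoch_succ, qPoch_succ,
      pow_succ q N, ← mul_assoc ρ]
    linear_combination omegaPM (x * √(1 - q) / 2) (y * √(1 - q) / 2) (ρ * q ^ N) * ih +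
      qPoch (ρ ^ 2) q (2 * N) * h

theorem tendsto_gammaPM_mul_pow {q ρ x y : ℝ} (hq : |q| < 1) (hρ : |ρ| < 1)
    (hx : x ∈ Sq q) (hy : y ∈ Sq q) :
    Filter.Tendsto (fun N : ℕ => gammaPM q (ρ * q ^ N) 0 0 x y) Filter.atTop (nhds 1) := by
  have h1 : (1 : ℝ) = ∑' n : ℕ, if n = 0 then 1 else 0 := (tsum_ite_eq 0 fun _ => (1 : ℝ)).symm
  rw [h1]
  refine tendsto_tsum_of_dominated_convergence (summable_gammaTerm hq hρ hx hy 0 0).norm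
    (fun n => ?_) (Filter.Eventually.of_forall fun N n => ?_)
  · cases n with
    | zero => simp [qFact, qHermite]
    | succ n =>
      have h2 : Filter.Tendsto (fun N : ℕ => ρ * q ^ N) Filter.atTop (nhds (ρ * 0)) :=
        (tendsto_pow_atTop_nhds_zero_of_abs_lt_one hq).const_mul ρ
      have h3 := ((((h2.pow (n + 1)).div_const (qFact q (n + 1))).mul_const
        (qHermite q (n + 1) x)).mul_const (qHermite q (n + 1) y))
      simpa using h3
  · simp only [gammaTerm, norm_mul, norm_div, norm_pow, mul_pow]
    gcongr
    refine mul_le_of_le_one_right (by positivity) (pow_le_one₀ (by positivity) ?_)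
    exact pow_le_one₀ (norm_nonneg q) hq.le

theorem summable_mul_pow {q : ℝ} (hq : |q| < 1) (a : ℝ) : Summable fun k : ℕ => ‖a * q ^ k‖ :=
  ((summable_geometric_of_abs_lt_one hq).mul_left a).norm

theorem tendsto_qPoch {q : ℝ} (hq : |q| < 1) (a : ℝ) :
    Filter.Tendsto (qPoch a q) Filter.atTop (nhds (qPochInf a q)) := by
  have h : Multipliable fun k : ℕ => 1 + -(a * q ^ k) :=
    multipliable_one_add_of_summable (by simpa only [norm_neg] using summable_mul_pow hq a)
  simp only [← sub_eq_add_neg] at h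
  exact h.hasProd.tendsto_prod_nat

theorem qPochInf_sq_ne_zero {q ρ : ℝ} (hq : |q| < 1) (hρ : |ρ| < 1) :
    qPochInf (ρ ^ 2) q ≠ 0 := by
  simp only [qPochInf, sub_eq_add_neg]
  refine tprod_one_add_ne_zero_of_summable (fun k => ?_)
    (by simpa only [norm_neg] using summable_mul_pow hq (ρ ^ 2))
  rw [← sub_eq_add_neg]
  exact (sq_mul_pow_lt_one hq hρ k).ne'

theorem multipliable_omegaPM {q : ℝ} (hq : |q| < 1) (ρ X Y : ℝ) :
    Multipliable fun k : ℕ => omegaPM X Y (ρ * q ^ k) := by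
  have h (m : ℕ) (c : ℝ) : Summable fun k : ℕ => c * (ρ * q ^ k) ^ (m + 1) := by
    have hm : |q ^ (m + 1)| < 1 := by
      rw [abs_pow]; exact pow_lt_one₀ (abs_nonneg q) hq m.succ_ne_zero
    refine ((summable_geometric_of_abs_lt_one hm).mul_left (c * ρ ^ (m + 1))).congr fun k => ?_
    rw [mul_pow, ← pow_mul, ← pow_mul, mul_comm k]
    ring
  have hs := (((h 0 (-4 * X * Y)).add (h 1 (4 * X ^ 2 + 4 * Y ^ 2 - 2))).add
    (h 2 (-4 * X * Y))).add (h 3 1)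
  refine (multipliable_one_add_of_summable hs.norm).congr fun k => ?_
  rw [omegaPM]
  ring

/-- The Poisson–Mehler formula. -/
theorem tprod_omegaPM_mul_gammaPM {q ρ x y : ℝ} (hq : |q| < 1) (hρ : |ρ| < 1)
    (hx : x ∈ Sq q) (hy : y ∈ Sq q) :
    (∏' k : ℕ, omegaPM (x * √(1 - q) / 2) (y * √(1 - q) / 2) (ρ * q ^ k)) *
      gammaPM q ρ 0 0 x y = qPochInf (ρ ^ 2) q := by
  have h1 := (multipliable_omegaPM hq ρ (x * √(1 - q) / 2)
    (y * √(1 - q) / 2)).hasProd.tendsto_prod_nat.mul_const (gammaPM q ρ 0 0 x y)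
  have h2 := ((tendsto_qPoch hq (ρ ^ 2)).comp
    (Filter.tendsto_id.const_mul_atTop' two_pos)).mul (tendsto_gammaPM_mul_pow hq hρ hx hy)
  rw [mul_one] at h2
  exact tendsto_nhds_unique h1 (h2.congr fun N => (prod_omegaPM_mul_gammaPM hq hρ hx hy N).symm)

theorem sum_antidiagonal_gammaDoubleTerm {q : ℝ} (hq : |q| < 1) (ρ x y : ℝ) (i j m : ℕ) :
    ∑ p ∈ Finset.HasAntidiagonal.antidiagonal m, gammaDoubleTerm q ρ i j x y p =
      if m = 0 then qHermite q i x * qHermite q j y else 0 := by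
  have h : ∑ p ∈ Finset.HasAntidiagonal.antidiagonal m, gammaDoubleTerm q ρ i j x y p =
      ρ ^ m / qFact q m * qHermite q (m + i) x * qHermite q (m + j) y *
        qAltSum q m (fun _ => 1) := by
    rw [Finset.Nat.sum_antidiagonal_eq_sum_range_succ_mk, qAltSum, Finset.mul_sum]
    refine Finset.sum_congr rfl fun s hs => ?_
    obtain ⟨d, rfl⟩ := Nat.exists_eq_add_of_le' (Nat.lt_succ_iff.1 (Finset.mem_range.1 hs))
    have h1 := (qFact_pos hq (d + s)).ne'
    have h2 := (qFact_pos hq d).ne'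
    have h3 := (qFact_pos hq s).ne'
    simp only [gammaDoubleTerm]
    rw [Nat.add_sub_cancel, qBinom_add, show d + (i + s) = d + s + i by ring,
      show d + (j + s) = d + s + j by ring, pow_add ρ]
    field_simp
  rw [h]
  cases m with
  | zero => simp [qAltSum_zero hq, qFact]
  | succ m => simp [qAltSum_one_eq_zero hq]

theorem hasSum_gammaDoubleTerm {q ρ x y : ℝ} (hq : |q| < 1) (hρ : |ρ| < 1)
    (hx : x ∈ Sq q) (hy : y ∈ Sq q) (i j : ℕ) :
    HasSum (gammaDoubleTerm q ρ i j x y) (qHermite q i x * qHermite q j y) := by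
  have hs := summable_gammaDoubleTerm hq hρ hx hy i j
  have h := ((Finset.HasAntidiagonal.sigmaAntidiagonalEquivProd.hasSum_iff).2 hs.hasSum).sigma
    fun m => hasSum_fintype _
  have h2 (m : ℕ) : (∑ p : Finset.HasAntidiagonal.antidiagonal m, gammaDoubleTerm q ρ i j x y p) =
      if m = 0 then qHermite q i x * qHermite q j y else 0 := by
    rw [Finset.sum_coe_sort, sum_antidiagonal_gammaDoubleTerm hq]
  have h3 : HasSum (fun m : ℕ => if m = 0 then qHermite q i x * qHermite q j y else 0)
      (∑' p, gammaDoubleTerm q ρ i j x y p) := by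
    simp only [← h2]
    exact h
  rw [← h3.unique (hasSum_ite_eq 0 _)]
  exact hs.hasSum

/-- H_i(x|q) H_j(y|q) ∏_{k≥0} ω(.,.|ρq^k) / (ρ²;q)_∞
= Σ_{k≥0} (-1)^k q^{k(k-1)/2} (ρ^k/[k]_q!) Q_{i+k,j+k}(x,y|ρ,q), the series converging. -/
theorem statement13 (q ρ x y : ℝ) (hq : |q| < 1) (hρ : |ρ| < 1)
    (hx : x ∈ Sq q) (hy : y ∈ Sq q) (i j : ℕ) :
    HasSum
      (fun k : ℕ => (-1 : ℝ) ^ k * q ^ (k * (k - 1) / 2) * ρ ^ k / qFact q k *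
        Qpoly q ρ (i + k) (j + k) x y)
      (qHermite q i x * qHermite q j y *
        (∏' k : ℕ,
          omegaPM (x * Real.sqrt (1 - q) / 2) (y * Real.sqrt (1 - q) / 2) (ρ * q ^ k)) /
        qPochInf (ρ ^ 2) q) := by
  have hP := qPochInf_sq_ne_zero hq hρ
  have hPM := tprod_omegaPM_mul_gammaPM hq hρ hx hy
  have hγ : gammaPM q ρ 0 0 x y ≠ 0 := right_ne_zero_of_mul (hPM ▸ hP)
  have h := ((hasSum_gammaDoubleTerm hq hρ hx hy i j).prod_fiberwise fun k =>
    (hasSum_gammaPM hq hρ hx hy (i + k) (j + k)).mul_left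
      ((-1 : ℝ) ^ k * q ^ (k * (k - 1) / 2) * ρ ^ k / qFact q k)).div_const
    (gammaPM q ρ 0 0 x y)
  have hval : qHermite q i x * qHermite q j y *
      (∏' k : ℕ, omegaPM (x * √(1 - q) / 2) (y * √(1 - q) / 2) (ρ * q ^ k)) /
        qPochInf (ρ ^ 2) q = qHermite q i x * qHermite q j y / gammaPM q ρ 0 0 x y := by
    rw [div_eq_div_iff hP hγ, ← hPM]
    ring
  rw [hval]
  refine hasSum_of_forall_eq h fun k => ?_
  rw [gammaPM_eq_Qpoly_mul hq hρ hx hy (i + k), ← mul_assoc, mul_div_cancel_right₀ _ hγ]
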